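/- arXiv:2304.00246 — 2 statements merged into one kernel-verified Lean document; each statement's English description precedes it below -/
import Mathlib

section
/- For all ordinals α, γ and all pairs of ordinals (β, ν): if (β, ν) < α and α < γ, then (β, ν) < γ. -/
open Ordinal

noncomputable section

/-- Evaluation of a base-`b` Cantor-normal-form list of (exponent, coefficient) pairs. -/
def evalCNF (b : Ordinal.{0}) (l : List (Ordinal.{0} × Ordinal.{0})) : Ordinal.{0} :=
  l.foldr (fun p r => b ^ p.1 * p.2 + r) 0

/-- The `i`-th segment (left partial sum) of the base-`b` Cantor normal form of `α`. -/
def cnfSegment (b α : Ordinal.{0}) (i : ℕ) : Ordinal.{0} :=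
  evalCNF b ((Ordinal.CNF b α).take (i + 1))

/-- `(β, ν) < α`: there is a segment `αᵢ` of the base-`b` Cantor normal form of `α`,
with corresponding exponent `ξᵢ`, such that `β < αᵢ` and `ν < ξᵢ`. -/
def pairLt (b β ν α : Ordinal.{0}) : Prop :=
  ∃ i : Fin (Ordinal.CNF b α).length,
    β < cnfSegment b α i ∧ ν < ((Ordinal.CNF b α).get i).1

/-- The relation `pairLt` with every segment of the normal form of `α` translated by `δ`. -/
def pairLtAdd (b β ν δ α : Ordinal.{0}) : Prop :=
  ∃ i : Fin (Ordinal.CNF b α).length,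
    β < δ + cnfSegment b α i ∧ ν < ((Ordinal.CNF b α).get i).1

theorem pairLtAdd_zero_left {b β ν α : Ordinal.{0}} :
    pairLtAdd b β ν 0 α ↔ pairLt b β ν α := by
  simp only [pairLtAdd, pairLt, zero_add]

theorem not_pairLtAdd_zero_right {b β ν δ : Ordinal.{0}} : ¬ pairLtAdd b β ν δ 0 := by
  rintro ⟨i, -⟩
  simpa using i.isLt

theorem pairLtAdd_iff_of_ne_zero {b β ν δ α : Ordinal.{0}} (hα : α ≠ 0) :
    pairLtAdd b β ν δ α ↔
      (β < δ + b ^ log b α * (α / b ^ log b α) ∧ ν < log b α) ∨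
        pairLtAdd b β ν (δ + b ^ log b α * (α / b ^ log b α)) (α % b ^ log b α) := by
  unfold pairLtAdd cnfSegment
  rw [CNF.ne_zero hα]
  simp only [List.length_cons]
  rw [Fin.exists_fin_succ]
  simp [evalCNF, add_assoc]

theorem pairLtAdd.lt {b β ν δ α : Ordinal.{0}} (h : pairLtAdd b β ν δ α) :
    β < δ + α ∧ ν < log b α := by
  induction α using CNF.rec b generalizing δ with
  | H0 => exact absurd h not_pairLtAdd_zero_right
  | H α hα ih =>
    rcases (pairLtAdd_iff_of_ne_zero hα).1 h with ⟨hβ, hν⟩ | h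
    · exact ⟨hβ.trans_le (by gcongr; exact mul_div_le _ _), hν⟩
    · obtain ⟨hβ, hν⟩ := ih h
      rw [add_assoc, div_add_mod] at hβ
      exact ⟨hβ, hν.trans_le (log_mono_right _ (mod_opow_log_lt_self b hα).le)⟩

theorem pairLtAdd.trans_lt {b β ν δ α γ : Ordinal.{0}} (hb : 1 < b)
    (h : pairLtAdd b β ν δ α) (hαγ : α < γ) : pairLtAdd b β ν δ γ := by
  induction α using CNF.rec b generalizing δ γ with
  | H0 => exact absurd h not_pairLtAdd_zero_right
  | H α hα ih =>
    have hγ : γ ≠ 0 := hαγ.ne_bot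
    rw [pairLtAdd_iff_of_ne_zero hγ]
    have hlog : log b α ≤ log b γ := log_mono_right _ hαγ.le
    rcases lt_or_ge α (b ^ log b γ * (γ / b ^ log b γ)) with hlt | hge
    · obtain ⟨hβ, hν⟩ := h.lt
      exact .inl ⟨hβ.trans (by gcongr), hν.trans_le hlog⟩
    · have hpos : b ^ log b γ ≠ 0 := opow_ne_zero _ hb.ne_bot
      have hle : b ^ log b γ ≤ α :=
        (le_mul_left _ (div_opow_log_pos b hγ)).trans hge
      have he : log b α = log b γ := hlog.antisymm ((opow_le_iff_le_log hb hα).1 hle)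
      have hq : α / b ^ log b γ = γ / b ^ log b γ :=
        (div_le_left hαγ.le _).antisymm ((mul_le_iff_le_div hpos).1 hge)
      rw [pairLtAdd_iff_of_ne_zero hα, he, hq] at h
      refine h.imp_right fun h => ?_
      rw [he] at ih
      refine ih h ?_
      rwa [← add_lt_add_iff_left (b ^ log b γ * (γ / b ^ log b γ)),
        div_add_mod γ, ← hq, div_add_mod α]

/-- If `(β, ν) < α` and `α < γ`, then `(β, ν) < γ`
(for the base-`Λ` normal form with `Λ` an uncountable regular cardinal). -/
theorem pairLt_of_lt (Λ : Cardinal.{0}) (hΛ : Cardinal.aleph0 < Λ) (hreg : Λ.IsRegular)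
    (α γ β ν : Ordinal.{0}) (h : pairLt Λ.ord β ν α) (hαγ : α < γ) :
    pairLt Λ.ord β ν γ := by
  have hb : 1 < Λ.ord := by
    rw [← Cardinal.ord_one, Cardinal.ord_lt_ord]
    exact Cardinal.one_lt_aleph0.trans hΛ
  exact pairLtAdd_zero_left.1 ((pairLtAdd_zero_left.2 h).trans_lt hb hαγ)
end
end

section
/- Every instance of Σ₁-Separation, of Δ₂-Separation, and of Σ₂-Replacement holds in every model of KPω + Π₁-Collection; that is, the theory KPω + Π₁-Collection proves Σ₁-Separation, Δ₂-Separation and Σ₂-Replacement. -/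
open FirstOrder FirstOrder.Language

/-- The type of relation symbols of the language of set theory:
a single binary relation `∈`. -/
inductive setRel : ℕ → Type
  | mem : setRel 2

/-- The language of set theory: a single binary relation symbol `∈`. -/
def LSet : Language := ⟨fun _ => Empty, setRel⟩

/-- The membership relation symbol. -/
def memRel : LSet.Relations 2 := setRel.mem

/-- The variable `vᵢ`. -/
def vr {n : ℕ} (i : Fin n) : LSet.Term (Empty ⊕ Fin n) := Term.var (Sum.inr i)

/-- The atomic formula `t₁ ∈ t₂`. -/
def memF {n : ℕ} (t₁ t₂ : LSet.Term (Empty ⊕ Fin n)) : LSet.BoundedFormula Empty n :=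
  Relations.boundedFormula₂ memRel t₁ t₂

/-- Conjunction. -/
def fand {n : ℕ} (φ ψ : LSet.BoundedFormula Empty n) : LSet.BoundedFormula Empty n :=
  (φ.imp ψ.not).not

/-- Disjunction. -/
def forr {n : ℕ} (φ ψ : LSet.BoundedFormula Empty n) : LSet.BoundedFormula Empty n :=
  φ.not.imp ψ

/-- Lift a term in context `n` to context `n + 1`. -/
def liftT {n : ℕ} (t : LSet.Term (Empty ⊕ Fin n)) : LSet.Term (Empty ⊕ Fin (n + 1)) :=
  t.relabel (Sum.map id Fin.castSucc)

/-- The bounded quantifier `∀ x ∈ t, φ`. -/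
def bAll {n : ℕ} (t : LSet.Term (Empty ⊕ Fin n)) (φ : LSet.BoundedFormula Empty (n + 1)) :
    LSet.BoundedFormula Empty n :=
  ((memF (vr (Fin.last n)) (liftT t)).imp φ).all

/-- The bounded quantifier `∃ x ∈ t, φ`. -/
def bEx {n : ℕ} (t : LSet.Term (Empty ⊕ Fin n)) (φ : LSet.BoundedFormula Empty (n + 1)) :
    LSet.BoundedFormula Empty n :=
  (fand (memF (vr (Fin.last n)) (liftT t)) φ).ex

/-- `Δ₀`-formulas: every quantifier is bounded. -/
inductive IsDelta0 : ∀ {n : ℕ}, LSet.BoundedFormula Empty n → Prop where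
  | falsum {n : ℕ} : IsDelta0 (⊥ : LSet.BoundedFormula Empty n)
  | equal {n : ℕ} (t₁ t₂ : LSet.Term (Empty ⊕ Fin n)) :
      IsDelta0 (BoundedFormula.equal t₁ t₂)
  | mem {n : ℕ} (t₁ t₂ : LSet.Term (Empty ⊕ Fin n)) : IsDelta0 (memF t₁ t₂)
  | imp {n : ℕ} {φ ψ : LSet.BoundedFormula Empty n} :
      IsDelta0 φ → IsDelta0 ψ → IsDelta0 (φ.imp ψ)
  | ball {n : ℕ} (t : LSet.Term (Empty ⊕ Fin n)) {φ : LSet.BoundedFormula Empty (n + 1)} :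
      IsDelta0 φ → IsDelta0 (bAll t φ)
  | bex {n : ℕ} (t : LSet.Term (Empty ⊕ Fin n)) {φ : LSet.BoundedFormula Empty (n + 1)} :
      IsDelta0 φ → IsDelta0 (bEx t φ)

/-- Extensionality: `∀a,b (∀x (x∈a ↔ x∈b) → a = b)`. -/
def extAx : LSet.Sentence :=
  BoundedFormula.alls (n := 2)
    ((((memF (vr (2 : Fin 3)) (vr 0)).iff (memF (vr 2) (vr 1))).all).imp
      (BoundedFormula.equal (vr (0 : Fin 2)) (vr 1)))

/-- Null set: `∃a ∀x (x ∉ a)`. -/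
def nullAx : LSet.Sentence := (((memF (vr (1 : Fin 2)) (vr 0)).not).all).ex

/-- Pair: `∀x,y ∃a (x∈a ∧ y∈a)`. -/
def pairAx : LSet.Sentence :=
  BoundedFormula.alls (n := 2)
    ((fand (memF (vr (0 : Fin 3)) (vr 2)) (memF (vr 1) (vr 2))).ex)

/-- Union: `∀a ∃b ∀x∈a ∀y∈x (y∈b)`. -/
def unionAx : LSet.Sentence :=
  BoundedFormula.alls (n := 1)
    ((bAll (vr (0 : Fin 2)) (bAll (vr (2 : Fin 3)) (memF (vr (3 : Fin 4)) (vr 1)))).ex)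

/-- Infinity: `∃x (∃y (y∈x) ∧ ∀y∈x ∃z∈x ∀w (w∈z ↔ (w∈y ∨ w=y)))`. -/
def infinityAx : LSet.Sentence :=
  (fand ((memF (vr (1 : Fin 2)) (vr 0)).ex)
    (bAll (vr (0 : Fin 1))
      (bEx (vr (0 : Fin 2))
        (((memF (vr (3 : Fin 4)) (vr 2)).iff
          (forr (memF (vr (3 : Fin 4)) (vr 1))
            (BoundedFormula.equal (vr (3 : Fin 4)) (vr 1)))).all)))).ex

/-- The separation axiom `∀c⃗ ∀a ∃b ∀x (x∈b ↔ (x∈a ∧ A(x)))` for a formula `A` with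
free variables among `v₀, …, vₙ` (`x = vₙ`, parameters `c⃗ = v₀, …, v_{n-1}`). -/
def sepAxOf (n : ℕ) (A : LSet.BoundedFormula Empty (n + 1)) : LSet.Sentence :=
  BoundedFormula.alls (n := n)
    (((((memF (vr (⟨n + 2, by omega⟩ : Fin (n + 3))) (vr ⟨n + 1, by omega⟩)).iff
        (fand (memF (vr (⟨n + 2, by omega⟩ : Fin (n + 3))) (vr ⟨n, by omega⟩))
          (A.liftAt 2 n))).all).ex).all)

/-- The collection axiom
`∀c⃗ ∀a (∀x∈a ∃y A(x,y) → ∃b ∀x∈a ∃y∈b A(x,y))` for a formula `A` with free variables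
among `v₀, …, v_{n+1}` (`x = vₙ`, `y = v_{n+1}`, parameters `c⃗ = v₀, …, v_{n-1}`). -/
def collAxOf (n : ℕ) (A : LSet.BoundedFormula Empty (n + 2)) : LSet.Sentence :=
  BoundedFormula.alls (n := n)
    (((bAll (vr (⟨n, by omega⟩ : Fin (n + 1))) ((A.liftAt 1 n).ex)).imp
      ((bAll (vr (⟨n, by omega⟩ : Fin (n + 2)))
        (bEx (vr (⟨n + 1, by omega⟩ : Fin (n + 3))) (A.liftAt 2 n))).ex)).all)

/-- The foundation axiom `∀c⃗ (∀x (∀y∈x F(y) → F(x)) → ∀x F(x))` for an arbitrary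
formula `F` with free variables among `v₀, …, vₙ` (`x = vₙ`). -/
def foundationAx (n : ℕ) (F : LSet.BoundedFormula Empty (n + 1)) : LSet.Sentence :=
  BoundedFormula.alls (n := n)
    (((((bAll (vr (⟨n, by omega⟩ : Fin (n + 1))) (F.liftAt 1 n)).imp F).all).imp F.all))

/-- The theory `KPω`. -/
def KPomega : LSet.Theory :=
  {extAx, nullAx, pairAx, unionAx, infinityAx} ∪
    (⋃ n : ℕ, {φ | ∃ A : LSet.BoundedFormula Empty (n + 1), IsDelta0 A ∧ φ = sepAxOf n A}) ∪
    (⋃ n : ℕ, {φ | ∃ A : LSet.BoundedFormula Empty (n + 2), IsDelta0 A ∧ φ = collAxOf n A}) ∪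
    (⋃ n : ℕ, {φ | ∃ F : LSet.BoundedFormula Empty (n + 1), φ = foundationAx n F})

/-- The `Π₁`-Collection scheme: collection for formulas `A(x, y) = ∀z δ(x, y, z)` with
`δ` a `Δ₀`-formula. -/
def Pi1Coll : LSet.Theory :=
  ⋃ n : ℕ, {φ | ∃ δ : LSet.BoundedFormula Empty (n + 3), IsDelta0 δ ∧ φ = collAxOf n δ.all}

/-- The `Σ₁`-Separation instance for `A(x) = ∃y δ(x, y)`, `δ ∈ Δ₀`
(`x = vₙ`, `y = v_{n+1}`). -/
def sigma1SepAx (n : ℕ) (δ : LSet.BoundedFormula Empty (n + 2)) : LSet.Sentence :=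
  sepAxOf n δ.ex

/-- The `Δ₂`-Separation instance
`∀c⃗ ∀a (∀x (A(x) ↔ B(x)) → ∃b ∀x (x∈b ↔ (x∈a ∧ A(x))))` where
`A(x) = ∃y ∀z δA(x,y,z)` is `Σ₂` and `B(x) = ∀y ∃z δB(x,y,z)` is `Π₂`
(`x = vₙ`, `y = v_{n+1}`, `z = v_{n+2}`). -/
def delta2SepAx (n : ℕ) (δA δB : LSet.BoundedFormula Empty (n + 3)) : LSet.Sentence :=
  BoundedFormula.alls (n := n)
    ((((((δA.all.ex).liftAt 1 n).iff ((δB.ex.all).liftAt 1 n)).all).imp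
      ((((memF (vr (⟨n + 2, by omega⟩ : Fin (n + 3))) (vr ⟨n + 1, by omega⟩)).iff
        (fand (memF (vr (⟨n + 2, by omega⟩ : Fin (n + 3))) (vr ⟨n, by omega⟩))
          ((δA.all.ex).liftAt 2 n))).all).ex)).all)

/-- The `Σ₂`-Replacement instance
`∀c⃗ ∀a (∀x∈a ∃!y A(x,y) → ∃b ∀x∈a ∃y∈b A(x,y))` where
`A(x,y) = ∃u ∀v δ(x,y,u,v)` is `Σ₂`
(`x = vₙ`, `y = v_{n+1}`, `u = v_{n+2}`, `v = v_{n+3}`). -/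
def sigma2ReplAx (n : ℕ) (δ : LSet.BoundedFormula Empty (n + 4)) : LSet.Sentence :=
  BoundedFormula.alls (n := n)
    (((bAll (vr (⟨n, by omega⟩ : Fin (n + 1)))
        ((fand ((δ.all.ex).liftAt 1 n)
          (((((δ.all.ex).liftAt 1 n).liftAt 1 (n + 2)).imp
            (BoundedFormula.equal (vr (⟨n + 3, by omega⟩ : Fin (n + 4)))
              (vr ⟨n + 2, by omega⟩))).all)).ex)).imp
      ((bAll (vr (⟨n, by omega⟩ : Fin (n + 2)))
        (bEx (vr (⟨n + 1, by omega⟩ : Fin (n + 3))) ((δ.all.ex).liftAt 2 n))).ex)).all)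

section SetStructure

variable {M : Type*} [LSet.Structure M]

/-- The interpretation of `∈` in a structure. -/
def Mem (x y : M) : Prop := Structure.RelMap memRel ![x, y]

/-- Realization of a formula without free variables other than the indexed ones. -/
def Sat {n : ℕ} (φ : LSet.BoundedFormula Empty n) (v : Fin n → M) : Prop :=
  φ.Realize default v

/-- The non-dependent version of `Fin.snoc`. -/
def push {β : Type*} {n : ℕ} (c : Fin n → β) (x : β) : Fin (n + 1) → β :=
  Fin.snoc (α := fun _ => β) c x

section push

variable {β γ : Type*} {n k : ℕ}

@[simp] theorem push_last (c : Fin n → β) (x : β) : push c x (Fin.last n) = x := by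
  simp [push]

@[simp] theorem push_castSucc (c : Fin n → β) (x : β) (i : Fin n) :
    push c x i.castSucc = c i := by
  simp [push]

@[simp] theorem comp_push (g : β → γ) (c : Fin n → β) (x : β) :
    g ∘ push c x = push (g ∘ c) (g x) := by
  ext i
  refine Fin.lastCases ?_ (fun j => ?_) i <;> simp

@[simp] theorem push_comp_castSucc (c : Fin n → β) (x : β) : push c x ∘ Fin.castSucc = c := by
  ext i; simp

@[simp] theorem push_comp_castSucc_comp (c : Fin n → β) (x : β) (g : Fin k → Fin n) :
    push c x ∘ Fin.castSucc ∘ g = c ∘ g := by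
  ext i; simp

theorem push_mk_eq (c : Fin n → β) (x : β) {i : ℕ} (h : i < n + 1) (hi : i = n) :
    push c x ⟨i, h⟩ = x := by
  subst hi; exact push_last c x

theorem push_mk_lt (c : Fin n → β) (x : β) {i : ℕ} (h : i < n + 1) (hi : i < n) :
    push c x ⟨i, h⟩ = c ⟨i, hi⟩ :=
  push_castSucc c x ⟨i, hi⟩

/-- Evaluating an environment at a variable renaming that skips entries. -/
theorem push_lift_one (c : Fin n → β) (a x : β) :
    (push (push c a) x ∘ fun i : Fin (n + 1) =>
      if (i : ℕ) < n then Fin.castAdd 1 i else Fin.addNat i 1) = push c x := by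
  ext i
  refine Fin.lastCases ?_ (fun j => ?_) i
  · simp [push_mk_eq, Fin.addNat]
  · simp only [Function.comp_apply, Fin.val_castSucc, j.isLt, if_true, push_castSucc]
    exact (push_castSucc _ _ j.castSucc).trans (push_castSucc _ _ j)

theorem push_lift_two (c : Fin n → β) (a b x : β) :
    (push (push (push c a) b) x ∘ fun i : Fin (n + 1) =>
      if (i : ℕ) < n then Fin.castAdd 2 i else Fin.addNat i 2) = push c x := by
  ext i
  refine Fin.lastCases ?_ (fun j => ?_) i
  · simp [push_mk_eq, Fin.addNat]
  · simp only [Function.comp_apply, Fin.val_castSucc, j.isLt, if_true, push_castSucc]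
    exact (push_castSucc _ _ j.castSucc.castSucc).trans
      ((push_castSucc _ _ j.castSucc).trans (push_castSucc _ _ j))

theorem push_push_lift_one (c : Fin n → β) (a x y : β) :
    (push (push (push c a) x) y ∘ fun i : Fin (n + 2) =>
      if (i : ℕ) < n then Fin.castAdd 1 i else Fin.addNat i 1) = push (push c x) y := by
  ext i
  refine Fin.lastCases ?_ (fun j => ?_) i
  · simp [push_mk_eq, Fin.addNat]
  · rw [push_castSucc, ← push_lift_one c a x]
    simp only [Function.comp_apply, Fin.val_castSucc]
    split_ifs
    · exact push_castSucc _ _ (Fin.castAdd 1 j)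
    · exact push_castSucc _ _ (Fin.addNat j 1)

theorem push_push_lift_two (c : Fin n → β) (a b x y : β) :
    (push (push (push (push c a) b) x) y ∘ fun i : Fin (n + 2) =>
      if (i : ℕ) < n then Fin.castAdd 2 i else Fin.addNat i 2) = push (push c x) y := by
  ext i
  refine Fin.lastCases ?_ (fun j => ?_) i
  · simp [push_mk_eq, Fin.addNat]
  · rw [push_castSucc, ← push_lift_two c a b x]
    simp only [Function.comp_apply, Fin.val_castSucc]
    split_ifs
    · exact push_castSucc _ _ (Fin.castAdd 2 j)
    · exact push_castSucc _ _ (Fin.addNat j 2)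

end push

section Sat

variable {n : ℕ} {φ ψ : LSet.BoundedFormula Empty n}

@[simp] theorem sat_falsum (v : Fin n → M) :
    Sat (⊥ : LSet.BoundedFormula Empty n) v ↔ False := Iff.rfl

@[simp] theorem sat_imp (v : Fin n → M) : Sat (φ.imp ψ) v ↔ (Sat φ v → Sat ψ v) := Iff.rfl

@[simp] theorem sat_not (v : Fin n → M) : Sat φ.not v ↔ ¬ Sat φ v := Iff.rfl

@[simp] theorem sat_iff (v : Fin n → M) : Sat (φ.iff ψ) v ↔ (Sat φ v ↔ Sat ψ v) :=
  BoundedFormula.realize_iff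

@[simp] theorem sat_fand (v : Fin n → M) : Sat (fand φ ψ) v ↔ Sat φ v ∧ Sat ψ v := by
  simp [fand]

@[simp] theorem sat_all {φ : LSet.BoundedFormula Empty (n + 1)} (v : Fin n → M) :
    Sat φ.all v ↔ ∀ x, Sat φ (push v x) := Iff.rfl

@[simp] theorem sat_ex {φ : LSet.BoundedFormula Empty (n + 1)} (v : Fin n → M) :
    Sat φ.ex v ↔ ∃ x, Sat φ (push v x) :=
  BoundedFormula.realize_ex

@[simp] theorem sat_mem (i j : Fin n) (v : Fin n → M) :
    Sat (memF (vr i) (vr j)) v ↔ Mem (v i) (v j) := by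
  simp [Sat, memF, vr, Mem, BoundedFormula.realize_rel₂]

theorem liftT_vr (i : Fin n) : liftT (vr i) = vr i.castSucc := rfl

@[simp] theorem sat_bAll {φ : LSet.BoundedFormula Empty (n + 1)} (i : Fin n) (v : Fin n → M) :
    Sat (bAll (vr i) φ) v ↔ ∀ x, Mem x (v i) → Sat φ (push v x) := by
  simp [bAll, liftT_vr]

@[simp] theorem sat_bEx {φ : LSet.BoundedFormula Empty (n + 1)} (i : Fin n) (v : Fin n → M) :
    Sat (bEx (vr i) φ) v ↔ ∃ x, Mem x (v i) ∧ Sat φ (push v x) := by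
  simp [bEx, liftT_vr]

theorem sat_liftAt {k m : ℕ} (h : m ≤ n) (v : Fin (n + k) → M) :
    Sat (φ.liftAt k m) v ↔
      Sat φ (v ∘ fun i => if (i : ℕ) < m then Fin.castAdd k i else Fin.addNat i k) :=
  BoundedFormula.realize_liftAt h

@[simp] theorem sat_lift_one {φ : LSet.BoundedFormula Empty (n + 1)}
    (c : Fin n → M) (a x : M) :
    Sat (φ.liftAt 1 n) (push (push c a) x) ↔ Sat φ (push c x) := by
  rw [← push_lift_one c a x]; exact sat_liftAt (by omega) _

@[simp] theorem sat_lift_two {φ : LSet.BoundedFormula Empty (n + 1)}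
    (c : Fin n → M) (a b x : M) :
    Sat (φ.liftAt 2 n) (push (push (push c a) b) x) ↔ Sat φ (push c x) := by
  rw [← push_lift_two c a b x]; exact sat_liftAt (by omega) _

@[simp] theorem sat_lift_one' {φ : LSet.BoundedFormula Empty (n + 2)}
    (c : Fin n → M) (a x y : M) :
    Sat (φ.liftAt 1 n) (push (push (push c a) x) y) ↔ Sat φ (push (push c x) y) := by
  rw [← push_push_lift_one c a x y]; exact sat_liftAt (by omega) _

@[simp] theorem sat_lift_two' {φ : LSet.BoundedFormula Empty (n + 2)}
    (c : Fin n → M) (a b x y : M) :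
    Sat (φ.liftAt 2 n) (push (push (push (push c a) b) x) y) ↔ Sat φ (push (push c x) y) := by
  rw [← push_push_lift_two c a b x y]; exact sat_liftAt (by omega) _

theorem realize_alls_iff : M ⊨ (BoundedFormula.alls φ : LSet.Sentence) ↔
    ∀ c : Fin n → M, Sat φ c :=
  BoundedFormula.realize_alls

end Sat

theorem realize_pairAx : M ⊨ pairAx ↔ ∀ x y : M, ∃ a, Mem x a ∧ Mem y a := by
  refine realize_alls_iff.trans ?_
  have h0 (c : Fin 2 → M) (z : M) : push c z 0 = c 0 := push_castSucc c z 0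
  have h1 (c : Fin 2 → M) (z : M) : push c z 1 = c 1 := push_castSucc c z 1
  have h2 (c : Fin 2 → M) (z : M) : push c z 2 = z := push_last c z
  simp only [sat_ex, sat_fand, sat_mem, h0, h1, h2]
  exact ⟨fun h x y => h ![x, y], fun h c => h _ _⟩

theorem realize_unionAx :
    M ⊨ unionAx ↔ ∀ a : M, ∃ b, ∀ x, Mem x a → ∀ y, Mem y x → Mem y b := by
  refine realize_alls_iff.trans ?_
  have e (c : Fin 1 → M) (b x y : M) :
      push (push c b) x 2 = x ∧ push (push (push c b) x) y 3 = y ∧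
      push (push (push c b) x) y 1 = b ∧ push c b 0 = c 0 :=
    ⟨push_last _ _, push_last _ _, (push_castSucc _ _ 1).trans
      ((push_castSucc _ _ 1).trans (push_last _ _)), push_castSucc _ _ 0⟩
  simp only [sat_ex, sat_bAll, sat_mem, e]
  exact ⟨fun h a => h ![a], fun h c => h _⟩

theorem realize_sepAxOf {n : ℕ} {A : LSet.BoundedFormula Empty (n + 1)} :
    M ⊨ sepAxOf n A ↔ ∀ (c : Fin n → M) (a : M), ∃ b, ∀ x,
      Mem x b ↔ Mem x a ∧ Sat A (push c x) := by
  refine realize_alls_iff.trans ?_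
  simp [push_mk_eq, push_mk_lt]

theorem realize_collAxOf {n : ℕ} {A : LSet.BoundedFormula Empty (n + 2)} :
    M ⊨ collAxOf n A ↔ ∀ (c : Fin n → M) (a : M),
      (∀ x, Mem x a → ∃ y, Sat A (push (push c x) y)) →
        ∃ b, ∀ x, Mem x a → ∃ y, Mem y b ∧ Sat A (push (push c x) y) := by
  refine realize_alls_iff.trans ?_
  simp [push_mk_eq, push_mk_lt]

theorem realize_delta2SepAx {n : ℕ} {δA δB : LSet.BoundedFormula Empty (n + 3)} :
    M ⊨ delta2SepAx n δA δB ↔ ∀ (c : Fin n → M) (a : M),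
      (∀ x, (∃ y, ∀ z, Sat δA (push (push (push c x) y) z)) ↔
        ∀ y, ∃ z, Sat δB (push (push (push c x) y) z)) →
      ∃ b, ∀ x, Mem x b ↔ Mem x a ∧ ∃ y, ∀ z, Sat δA (push (push (push c x) y) z) := by
  refine realize_alls_iff.trans ?_
  simp [push_mk_eq, push_mk_lt]

theorem realize_sigma2ReplAx_of_collection {n : ℕ} {δ : LSet.BoundedFormula Empty (n + 4)}
    (h : ∀ (c : Fin n → M) (a : M),
      (∀ x, Mem x a → ∃ y u, ∀ v, Sat δ (push (push (push (push c x) y) u) v)) →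
      ∃ b, ∀ x, Mem x a → ∃ y, Mem y b ∧
        ∃ u, ∀ v, Sat δ (push (push (push (push c x) y) u) v)) :
    M ⊨ sigma2ReplAx n δ := by
  refine realize_alls_iff.2 fun c => ?_
  simp only [sat_all, sat_imp, sat_bAll, sat_ex, sat_fand, sat_bEx, sat_lift_one', sat_lift_two',
    push_mk_eq, push_mk_lt, lt_add_iff_pos_right, zero_lt_one]
  intro a ha
  exact h c a fun x hx => (ha x hx).imp fun y hy => hy.1

/-- A predicate on environments is `Δ₀` if it is defined by a `Δ₀`-formula. -/
def Delta0Pred {n : ℕ} (P : (Fin n → M) → Prop) : Prop :=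
  ∃ φ : LSet.BoundedFormula Empty n, IsDelta0 φ ∧ ∀ v, Sat φ v ↔ P v

theorem exists_vr_eq {n : ℕ} (t : LSet.Term (Empty ⊕ Fin n)) : ∃ i, t = vr i := by
  rcases t with (e | i) | ⟨f, _⟩
  · exact e.elim
  · exact ⟨i, rfl⟩
  · exact Empty.elim f

theorem IsDelta0.delta0Pred {n : ℕ} {φ : LSet.BoundedFormula Empty n} (h : IsDelta0 φ) :
    Delta0Pred (M := M) (Sat φ) :=
  ⟨φ, h, fun _ => Iff.rfl⟩

/-- `Δ₀`-formulas are closed under renaming of variables. -/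
theorem IsDelta0.delta0Pred_comp {n : ℕ} {φ : LSet.BoundedFormula Empty n} (h : IsDelta0 φ) :
    ∀ {m : ℕ} (f : Fin n → Fin m), Delta0Pred (M := M) fun v => Sat φ (v ∘ f) := by
  induction h with
  | falsum => exact fun f => ⟨⊥, .falsum, fun _ => Iff.rfl⟩
  | equal t₁ t₂ =>
    intro m f
    obtain ⟨i, rfl⟩ := exists_vr_eq t₁
    obtain ⟨j, rfl⟩ := exists_vr_eq t₂
    exact ⟨_, .equal (vr (f i)) (vr (f j)), fun _ => Iff.rfl⟩
  | mem t₁ t₂ =>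
    intro m f
    obtain ⟨i, rfl⟩ := exists_vr_eq t₁
    obtain ⟨j, rfl⟩ := exists_vr_eq t₂
    exact ⟨_, .mem (vr (f i)) (vr (f j)), by simp⟩
  | imp _ _ ih₁ ih₂ =>
    intro m f
    obtain ⟨ψ₁, h₁, e₁⟩ := ih₁ f
    obtain ⟨ψ₂, h₂, e₂⟩ := ih₂ f
    exact ⟨_, .imp h₁ h₂, by simp [e₁, e₂]⟩
  | ball t _ ih =>
    intro m f
    obtain ⟨i, rfl⟩ := exists_vr_eq t
    obtain ⟨ψ, h, e⟩ := ih (push (Fin.castSucc ∘ f) (Fin.last m))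
    exact ⟨_, .ball (vr (f i)) h, by simp [e]⟩
  | bex t _ ih =>
    intro m f
    obtain ⟨i, rfl⟩ := exists_vr_eq t
    obtain ⟨ψ, h, e⟩ := ih (push (Fin.castSucc ∘ f) (Fin.last m))
    exact ⟨_, .bex (vr (f i)) h, by simp [e]⟩

namespace Delta0Pred

variable {n : ℕ} {P Q : (Fin n → M) → Prop}

theorem comp (h : Delta0Pred P) {m : ℕ} (f : Fin n → Fin m) :
    Delta0Pred fun v => P (v ∘ f) := by
  obtain ⟨φ, hφ, e⟩ := h
  simpa only [e] using hφ.delta0Pred_comp (M := M) f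

theorem imp (hP : Delta0Pred P) (hQ : Delta0Pred Q) : Delta0Pred fun v => P v → Q v := by
  obtain ⟨φ, hφ, e⟩ := hP
  obtain ⟨ψ, hψ, e'⟩ := hQ
  exact ⟨_, .imp hφ hψ, by simp [e, e']⟩

theorem not (hP : Delta0Pred P) : Delta0Pred fun v => ¬ P v :=
  hP.imp (Q := fun _ => False) ⟨⊥, .falsum, by simp⟩

theorem or (hP : Delta0Pred P) (hQ : Delta0Pred Q) : Delta0Pred fun v => P v ∨ Q v := by
  simpa only [or_iff_not_imp_left] using hP.not.imp hQ

theorem mem (i j : Fin n) : Delta0Pred fun v : Fin n → M => Mem (v i) (v j) :=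
  ⟨_, .mem (vr i) (vr j), by simp⟩

theorem ball {R : (Fin (n + 1) → M) → Prop} (h : Delta0Pred R) (i : Fin n) :
    Delta0Pred fun v => ∀ x, Mem x (v i) → R (push v x) := by
  obtain ⟨φ, hφ, e⟩ := h
  exact ⟨_, .ball (vr i) hφ, by simp [e]⟩

theorem bex {R : (Fin (n + 1) → M) → Prop} (h : Delta0Pred R) (i : Fin n) :
    Delta0Pred fun v => ∃ x, Mem x (v i) ∧ R (push v x) := by
  obtain ⟨φ, hφ, e⟩ := h
  exact ⟨_, .bex (vr i) hφ, by simp [e]⟩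

theorem bex_ball {R : (Fin (n + 2) → M) → Prop} (h : Delta0Pred R) {m : ℕ} (f : Fin n → Fin m)
    (i j : Fin m) : Delta0Pred fun v : Fin m → M =>
      ∃ y, Mem y (v i) ∧ ∀ z, Mem z (v j) → R (push (push (v ∘ f) y) z) := by
  have := ((h.comp (push (push (Fin.castSucc ∘ Fin.castSucc ∘ f) (Fin.last m).castSucc)
    (Fin.last (m + 1)))).ball j.castSucc).bex i
  simpa using this

end Delta0Pred

section Model

variable [hM : M ⊨ (KPomega ∪ Pi1Coll)] {n : ℕ}

include hM

theorem exists_mem_mem (x y : M) : ∃ a, Mem x a ∧ Mem y a :=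
  realize_pairAx.1 (Theory.realize_sentence_of_mem (KPomega ∪ Pi1Coll) (by simp [KPomega])) x y

theorem exists_union (a : M) : ∃ b, ∀ x, Mem x a → ∀ y, Mem y x → Mem y b :=
  realize_unionAx.1 (Theory.realize_sentence_of_mem (KPomega ∪ Pi1Coll) (by simp [KPomega])) a

theorem delta0_separation {P : (Fin (n + 1) → M) → Prop} (h : Delta0Pred P)
    (c : Fin n → M) (a : M) : ∃ b, ∀ x, Mem x b ↔ Mem x a ∧ P (push c x) := by
  obtain ⟨φ, hφ, e⟩ := h
  simp only [← e]
  refine realize_sepAxOf.1 (Theory.realize_sentence_of_mem (KPomega ∪ Pi1Coll) ?_) c a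
  exact .inl (.inl (.inl (.inr (Set.mem_iUnion.2 ⟨n, φ, hφ, rfl⟩))))

theorem delta0_collection {P : (Fin (n + 2) → M) → Prop} (h : Delta0Pred P)
    (c : Fin n → M) (a : M) (ha : ∀ x, Mem x a → ∃ y, P (push (push c x) y)) :
    ∃ b, ∀ x, Mem x a → ∃ y, Mem y b ∧ P (push (push c x) y) := by
  obtain ⟨φ, hφ, e⟩ := h
  simp only [← e] at ha ⊢
  refine realize_collAxOf.1 (Theory.realize_sentence_of_mem (KPomega ∪ Pi1Coll) ?_) c a ha
  exact .inl (.inl (.inr (Set.mem_iUnion.2 ⟨n, φ, hφ, rfl⟩)))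

theorem pi1_collection {P : (Fin (n + 3) → M) → Prop} (h : Delta0Pred P)
    (c : Fin n → M) (a : M)
    (ha : ∀ x, Mem x a → ∃ y, ∀ z, P (push (push (push c x) y) z)) :
    ∃ b, ∀ x, Mem x a → ∃ y, Mem y b ∧ ∀ z, P (push (push (push c x) y) z) := by
  obtain ⟨φ, hφ, e⟩ := h
  simp only [← e, ← sat_all] at ha ⊢
  refine realize_collAxOf.1 (Theory.realize_sentence_of_mem (KPomega ∪ Pi1Coll) ?_) c a ha
  exact .inr (Set.mem_iUnion.2 ⟨n, φ, hφ, rfl⟩)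

theorem sigma1_separation {P : (Fin (n + 2) → M) → Prop} (h : Delta0Pred P)
    (c : Fin n → M) (a : M) :
    ∃ b, ∀ x, Mem x b ↔ Mem x a ∧ ∃ y, P (push (push c x) y) := by
  have hQ : Delta0Pred fun v : Fin (n + 3) → M => P (v ∘ Fin.castSucc) ∨
      ¬ P (v ∘ push (Fin.castSucc ∘ Fin.castSucc) (Fin.last (n + 2))) :=
    (h.comp _).or (h.comp _).not
  obtain ⟨b, hb⟩ := pi1_collection hQ c a fun x _ => by
    by_cases hx : ∃ y, P (push (push c x) y)
    · exact hx.imp fun y hy z => by simp [hy]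
    · exact ⟨x, fun z => .inr (by simpa using not_exists.1 hx z)⟩
  have hR := (h.comp (push (push (Fin.castSucc ∘ Fin.castSucc ∘ Fin.castSucc)
    (Fin.last (n + 1)).castSucc) (Fin.last (n + 2)))).bex (Fin.last n).castSucc
  obtain ⟨d, hd⟩ := delta0_separation hR (push c b) a
  refine ⟨d, fun x => (hd x).trans (and_congr_right fun hx => ?_)⟩
  simp only [push_castSucc, push_last, comp_push, push_comp_castSucc, push_comp_castSucc_comp]
  refine ⟨fun ⟨y, _, hy⟩ => ⟨y, hy⟩, fun ⟨z, hz⟩ => ?_⟩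
  obtain ⟨y, hyb, hy⟩ := hb x hx
  have := hy z
  simp only [push_last, comp_push, push_comp_castSucc, push_comp_castSucc_comp] at this
  exact ⟨y, hyb, this.resolve_right (not_not.2 hz)⟩

theorem pi1_separation {P : (Fin (n + 2) → M) → Prop} (h : Delta0Pred P)
    (c : Fin n → M) (a : M) :
    ∃ b, ∀ x, Mem x b ↔ Mem x a ∧ ∀ y, P (push (push c x) y) := by
  obtain ⟨d, hd⟩ := sigma1_separation h.not c a
  obtain ⟨b, hb⟩ := delta0_separation
    (Delta0Pred.mem (M := M) (Fin.last (n + 1)) (Fin.last n).castSucc).not (push c d) a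
  refine ⟨b, fun x => (hb x).trans (and_congr_right fun hx => ?_)⟩
  simp [hd, hx]

/-- `∃ y ∈ w, ∀ z, P` is `Π₁` when `P` is `Δ₀`. -/
theorem exists_mem_forall_iff {P : (Fin (n + 2) → M) → Prop} (h : Delta0Pred P)
    (c : Fin n → M) (w : M) :
    (∃ y, Mem y w ∧ ∀ z, P (push (push c y) z)) ↔
      ∀ V, ∃ y, Mem y w ∧ ∀ z, Mem z V → P (push (push c y) z) := by
  refine ⟨fun ⟨y, hy, hP⟩ V => ⟨y, hy, fun z _ => hP z⟩, fun H => ?_⟩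
  by_contra! hw
  obtain ⟨V, hV⟩ := delta0_collection h.not c w hw
  obtain ⟨y, hy, hP⟩ := H V
  obtain ⟨z, hz, hPz⟩ := hV y hy
  exact hPz (hP z hz)

theorem forall_or_forall_iff (p q : M → Prop) :
    ((∀ z, p z) ∨ ∀ z, q z) ↔ ∀ V, (∀ z, Mem z V → p z) ∨ ∀ z, Mem z V → q z := by
  refine ⟨fun h V => h.imp (fun h z _ => h z) fun h z _ => h z, fun h => ?_⟩
  by_contra! hpq
  obtain ⟨⟨x, hx⟩, y, hy⟩ := hpq
  obtain ⟨V, hxV, hyV⟩ := exists_mem_mem x y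
  exact (h V).elim (fun h => hx (h x hxV)) fun h => hy (h y hyV)

theorem exists_mem_forall_separation {P : (Fin (n + 3) → M) → Prop} (h : Delta0Pred P)
    (c : Fin n → M) (b a : M) : ∃ d, ∀ x, Mem x d ↔ Mem x a ∧
      ∃ y, Mem y b ∧ ∀ z, P (push (push (push c x) y) z) := by
  have := pi1_separation (h.bex_ball (push (Fin.castSucc ∘ Fin.castSucc ∘ Fin.castSucc)
    (Fin.last (n + 1)).castSucc) (Fin.last n).castSucc.castSucc (Fin.last (n + 2))) (push c b) a
  simpa [exists_mem_forall_iff h] using this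

theorem delta2_separation {P Q : (Fin (n + 3) → M) → Prop} (hP : Delta0Pred P)
    (hQ : Delta0Pred Q) (c : Fin n → M) (a : M)
    (hPQ : ∀ x, (∃ y, ∀ z, P (push (push (push c x) y) z)) ↔
      ∀ y, ∃ z, Q (push (push (push c x) y) z)) :
    ∃ b, ∀ x, Mem x b ↔ Mem x a ∧ ∃ y, ∀ z, P (push (push (push c x) y) z) := by
  let f : Fin (n + 3) → Fin (n + 4) := push (Fin.castSucc ∘ Fin.castSucc) (Fin.last (n + 3))
  have hR := ((hP.comp f).ball (Fin.last (n + 2))).or ((hQ.not.comp f).ball (Fin.last (n + 2)))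
  obtain ⟨b, hb⟩ := pi1_collection hR c a fun x _ => by
    simp only [f, push_last, comp_push, push_comp_castSucc, push_comp_castSucc_comp,
      ← forall_or_forall_iff]
    by_cases hx : ∃ y, ∀ z, P (push (push (push c x) y) z)
    · exact hx.imp fun y => .inl
    · have := mt (hPQ x).2 hx
      push Not at this
      exact this.imp fun y => .inr
  simp only [f, push_last, comp_push, push_comp_castSucc, push_comp_castSucc_comp,
    ← forall_or_forall_iff] at hb
  obtain ⟨d, hd⟩ := exists_mem_forall_separation hP c b a
  refine ⟨d, fun x => (hd x).trans (and_congr_right fun hx => ?_)⟩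
  refine ⟨fun ⟨y, _, hy⟩ => ⟨y, hy⟩, fun H => ?_⟩
  obtain ⟨y, hyb, hy | hy⟩ := hb x hx
  · exact ⟨y, hyb, hy⟩
  · obtain ⟨z, hz⟩ := (hPQ x).1 H y
    exact absurd hz (hy z)

theorem sigma2_collection {P : (Fin (n + 4) → M) → Prop} (h : Delta0Pred P)
    (c : Fin n → M) (a : M)
    (ha : ∀ x, Mem x a → ∃ y u, ∀ v, P (push (push (push (push c x) y) u) v)) :
    ∃ b, ∀ x, Mem x a → ∃ y, Mem y b ∧ ∃ u, ∀ v, P (push (push (push (push c x) y) u) v) := by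
  let f : Fin (n + 2) → Fin (n + 3) := push (Fin.castSucc ∘ Fin.castSucc) (Fin.last (n + 2))
  have hinner := h.comp (push (push (Fin.castSucc ∘ Fin.castSucc ∘ f)
    (Fin.last (n + 3)).castSucc) (Fin.last (n + 4)))
  have houter := h.bex_ball (Fin.castSucc ∘ f) (Fin.last (n + 1)).castSucc.castSucc
    (Fin.last (n + 3))
  have hmatrix := houter.bex_ball Fin.castSucc (Fin.last (n + 1)).castSucc (Fin.last (n + 2))
  have key (x w : M) :
      (∃ y, Mem y w ∧ ∃ u, Mem u w ∧ ∀ v, P (push (push (push (push c x) y) u) v)) ↔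
      ∀ B, ∃ y, Mem y w ∧ ∀ V, Mem V B → ∃ u, Mem u w ∧ ∀ v, Mem v V →
        P (push (push (push (push c x) y) u) v) := by
    have h₁ (y : M) := exists_mem_forall_iff hinner (push (push (push c x) w) y) w
    have h₂ := exists_mem_forall_iff houter (push (push c x) w) w
    simp only [f, push_last, push_castSucc, comp_push, push_comp_castSucc,
      push_comp_castSucc_comp] at h₁ h₂
    simp only [h₁, h₂]
  obtain ⟨b, hb⟩ := pi1_collection hmatrix c a fun x hx => by
    obtain ⟨y, u, hyu⟩ := ha x hx
    obtain ⟨w, hy, hu⟩ := exists_mem_mem y u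
    refine ⟨w, ?_⟩
    simpa [f] using (key x w).1 ⟨y, hy, u, hu, hyu⟩
  obtain ⟨d, hd⟩ := exists_union b
  refine ⟨d, fun x hx => ?_⟩
  obtain ⟨w, hw, H⟩ := hb x hx
  obtain ⟨y, hy, u, -, hyu⟩ := (key x w).2 (by simpa [f] using H)
  exact ⟨y, hd w hw y hy, u, hyu⟩

end Model

end SetStructure

/-- `KPω + Π₁-Collection` proves `Σ₁`-Separation, `Δ₂`-Separation and
`Σ₂`-Replacement: every instance of these schemes holds in every model of
`KPω + Π₁-Collection`. -/
theorem kp_pi1coll_proves_sep_repl :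
    (∀ (n : ℕ) (δ : LSet.BoundedFormula Empty (n + 2)), IsDelta0 δ →
      (KPomega ∪ Pi1Coll) ⊨ᵇ sigma1SepAx n δ) ∧
    (∀ (n : ℕ) (δA δB : LSet.BoundedFormula Empty (n + 3)), IsDelta0 δA → IsDelta0 δB →
      (KPomega ∪ Pi1Coll) ⊨ᵇ delta2SepAx n δA δB) ∧
    (∀ (n : ℕ) (δ : LSet.BoundedFormula Empty (n + 4)), IsDelta0 δ →
      (KPomega ∪ Pi1Coll) ⊨ᵇ sigma2ReplAx n δ) := by
  refine ⟨fun n δ hδ => ?_, fun n δA δB hA hB => ?_, fun n δ hδ => ?_⟩ <;>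
    refine Theory.models_sentence_iff.2 fun M => ?_
  · refine realize_sepAxOf.2 fun c a => ?_
    simpa only [sat_ex] using sigma1_separation hδ.delta0Pred c a
  · exact realize_delta2SepAx.2 fun c a => delta2_separation hA.delta0Pred hB.delta0Pred c a
  · exact realize_sigma2ReplAx_of_collection fun c a => sigma2_collection hδ.delta0Pred c a
end
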